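/- The map Ψ defined by Ψ(f)(g) := T(fg) for f, g ∈ L²(T) is a bijection between E = L²(T) and its T-strong dual Ê; moreover Ψ is additive, R(T)-homogeneous, and R(T)-valued norm preserving in the sense that ‖Ψ(f)‖ = ‖f‖_{T,2} for all f ∈ L²(T). -/

import Mathlib

/-- `p` is a component of the weak order unit `e`: `0 ≤ p ≤ e` and `p ∧ (e - p) = 0`. -/
def IsComponent {E : Type*} [AddCommGroup E] [Lattice E] (e p : E) : Prop :=
  0 ≤ p ∧ p ≤ e ∧ p ⊓ (e - p) = 0

/-- The setting of the Riesz-Frechet representation theorem, formulated inside the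
universal completion `U = E_u` with its `f`-algebra structure whose multiplicative
unit `1` is the chosen weak order unit `e` (with `Te = e`).  `L1` is the
`T`-universally complete space `E = L¹(T)`, `RT` is the range `R(T)` of the strictly
positive conditional expectation operator `T`, and `sqrt` is the (unique positive)
square root in the universally complete `f`-algebra `R(T)`. -/
structure CESetup (U : Type*) [CommRing U] [ConditionallyCompleteLattice U]
    [CovariantClass U U (· + ·) (· ≤ ·)] [Module ℝ U] [PosSMulMono ℝ U] where
  /-- `E = L¹(T)`, the natural domain of `T` -/
  L1 : Set U
  /-- `R(T)`, the range of `T` -/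
  RT : Set U
  /-- the strictly positive conditional expectation operator -/
  T : U → U
  /-- the square root in the universally complete `f`-algebra -/
  sqrt : U → U
  /-- `U` is an `f`-algebra: products of positives are positive -/
  mul_nonneg : ∀ x y : U, 0 ≤ x → 0 ≤ y → 0 ≤ x * y
  /-- `U` is an `f`-algebra: `x ⊓ y = 0` implies `(x z) ⊓ y = 0` for `z ≥ 0` -/
  falg : ∀ x y z : U, x ⊓ y = 0 → 0 ≤ z → (x * z) ⊓ y = 0
  one_pos : (0 : U) < 1
  /-- `e = 1` is a weak order unit -/
  one_weak : ∀ x : U, 0 ≤ x → x ⊓ 1 = 0 → x = 0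
  /-- `L¹(T)` is a Riesz subspace, in fact an order ideal, of `U` -/
  L1_zero : (0 : U) ∈ L1
  L1_add : ∀ x ∈ L1, ∀ y ∈ L1, x + y ∈ L1
  L1_smul : ∀ (c : ℝ), ∀ x ∈ L1, c • x ∈ L1
  L1_ideal : ∀ x : U, ∀ y ∈ L1, |x| ≤ |y| → x ∈ L1
  L1_one : (1 : U) ∈ L1
  /-- `L¹(T)` is an `R(T)`-module -/
  L1_module : ∀ r ∈ RT, ∀ x ∈ L1, r * x ∈ L1
  /-- `R(T)` is a Riesz subspace and subalgebra of `U`, contained in `L¹(T)` -/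
  RT_sub : RT ⊆ L1
  RT_zero : (0 : U) ∈ RT
  RT_one : (1 : U) ∈ RT
  RT_add : ∀ x ∈ RT, ∀ y ∈ RT, x + y ∈ RT
  RT_neg : ∀ x ∈ RT, -x ∈ RT
  RT_smul : ∀ (c : ℝ), ∀ x ∈ RT, c • x ∈ RT
  RT_mul : ∀ x ∈ RT, ∀ y ∈ RT, x * y ∈ RT
  RT_sup : ∀ x ∈ RT, ∀ y ∈ RT, x ⊔ y ∈ RT
  /-- `R(T)` is order closed in `U` -/
  RT_orderClosed : ∀ S ⊆ RT, S.Nonempty → BddAbove S → sSup S ∈ RT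
  /-- `T` is linear on `L¹(T)` -/
  T_add : ∀ x ∈ L1, ∀ y ∈ L1, T (x + y) = T x + T y
  T_smul : ∀ (c : ℝ), ∀ x ∈ L1, T (c • x) = c • T x
  /-- `T` is positive -/
  T_pos : ∀ x ∈ L1, 0 ≤ x → 0 ≤ T x
  /-- `T` is strictly positive -/
  T_strict : ∀ x ∈ L1, 0 ≤ x → T x = 0 → x = 0
  /-- `T` maps into `R(T)` -/
  T_mem : ∀ x ∈ L1, T x ∈ RT
  /-- `T` is a projection onto `R(T)` -/
  T_fix : ∀ r ∈ RT, T r = r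
  /-- `T e = e` for the weak order unit `e = 1` -/
  T_one : T 1 = 1
  /-- `T` is an averaging operator: `T(rg) = r T(g)` for `r ∈ R(T)`, `g ∈ L¹(T)` -/
  T_avg : ∀ r ∈ RT, ∀ g ∈ L1, T (r * g) = r * T g
  /-- `T` is order continuous -/
  T_ordCont : ∀ S ⊆ L1, S.Nonempty → DirectedOn (· ≥ ·) S → (∀ x ∈ S, 0 ≤ x) →
    sInf S = 0 → sInf (T '' S) = 0
  /-- `E` is `T`-universally complete, `E = L¹(T)`: every upward directed set of
  positive elements of `L¹(T)` whose `T`-image is order bounded has a supremum,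
  which lies in `L¹(T)` -/
  T_univComplete : ∀ S ⊆ L1, S.Nonempty → DirectedOn (· ≤ ·) S → (∀ x ∈ S, 0 ≤ x) →
    (∃ b : U, ∀ x ∈ S, T x ≤ b) → BddAbove S ∧ sSup S ∈ L1
  /-- properties of the square root -/
  sqrt_nonneg : ∀ x : U, 0 ≤ sqrt x
  sqrt_sq : ∀ x : U, 0 ≤ x → sqrt x * sqrt x = x
  sqrt_mem : ∀ x ∈ RT, 0 ≤ x → sqrt x ∈ RT

namespace CESetup

variable {U : Type*} [CommRing U] [ConditionallyCompleteLattice U]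
  [CovariantClass U U (· + ·) (· ≤ ·)] [Module ℝ U] [PosSMulMono ℝ U]

/-- `E = L²(T) = {f ∈ L¹(T) : f² ∈ L¹(T)}`. -/
def L2 (s : CESetup U) : Set U := {f | f ∈ s.L1 ∧ f * f ∈ s.L1}

/-- The `R(T)`-valued norm `‖f‖_{T,2} = (T(f²))^{1/2}` on `L²(T)`. -/
noncomputable def norm2 (s : CESetup U) (f : U) : U := s.sqrt (s.T (f * f))

/-- `F` is a `T`-linear functional on `E = L²(T)`: an additive, `R(T)`-homogeneous,
order continuous map `E → R(T)`. -/
def IsTLinear (s : CESetup U) (F : U → U) : Prop :=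
  (∀ f ∈ s.L2, F f ∈ s.RT) ∧
  (∀ f ∈ s.L2, ∀ g ∈ s.L2, F (f + g) = F f + F g) ∧
  (∀ r ∈ s.RT, ∀ f ∈ s.L2, F (r * f) = r * F f) ∧
  (∀ S ⊆ s.L2, S.Nonempty → DirectedOn (· ≥ ·) S → (∀ x ∈ S, 0 ≤ x) → sInf S = 0 →
    ∃ w : U → U, (∀ p ∈ S, ∀ q ∈ S, p ≤ q → w p ≤ w q) ∧ sInf (w '' S) = 0 ∧
      ∀ p ∈ S, |F p| ≤ w p)

/-- `F` is `T`-strongly bounded: `|F(g)| ≤ k ‖g‖_{T,2}` for some `k ∈ R(T)⁺`.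
The `T`-strong dual `Ê` consists of the `T`-strongly bounded `T`-linear functionals. -/
def IsStronglyBounded (s : CESetup U) (F : U → U) : Prop :=
  ∃ k ∈ s.RT, 0 ≤ k ∧ ∀ g ∈ s.L2, |F g| ≤ k * s.norm2 g

/-- The `R(T)`-valued norm on the `T`-strong dual `Ê`:
`‖F‖ = inf {k ∈ R(T)⁺ : |F(g)| ≤ k ‖g‖_{T,2} for all g}`. -/
noncomputable def opNorm (s : CESetup U) (F : U → U) : U :=
  sInf {k | k ∈ s.RT ∧ 0 ≤ k ∧ ∀ g ∈ s.L2, |F g| ≤ k * s.norm2 g}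

end CESetup

namespace FAlgebra

variable {U : Type*} [CommRing U] [ConditionallyCompleteLattice U]

/-- `S` is a downward directed set of positive elements with infimum `0`. -/
def DecreasesToZero (S : Set U) : Prop :=
  S.Nonempty ∧ DirectedOn (· ≥ ·) S ∧ (∀ x ∈ S, 0 ≤ x) ∧ ∀ b, (∀ x ∈ S, b ≤ x) → b ≤ 0

lemma sInf_eq_zero_of_forall {S : Set U} (hne : S.Nonempty) (h0 : ∀ x ∈ S, 0 ≤ x)
    (hb : ∀ b, (∀ x ∈ S, b ≤ x) → b ≤ 0) : sInf S = 0 :=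
  IsGLB.csInf_eq ⟨h0, fun b h => hb b h⟩ hne

lemma DecreasesToZero.sInf_eq {S : Set U} (h : DecreasesToZero S) : sInf S = 0 :=
  sInf_eq_zero_of_forall h.1 h.2.2.1 h.2.2.2

lemma DecreasesToZero.of_sInf {S : Set U} (hne : S.Nonempty) (hS : DirectedOn (· ≥ ·) S)
    (h0 : ∀ x ∈ S, 0 ≤ x) (h : sInf S = 0) : DecreasesToZero S :=
  ⟨hne, hS, h0, fun _ hb => h ▸ le_csInf hne hb⟩

variable [IsOrderedRing U]

/-- Dedekind complete ordered groups are Archimedean. -/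
lemma nonpos_of_forall_natCast_mul_le {b c : U} (h : ∀ n : ℕ, (n : U) * b ≤ c) : b ≤ 0 := by
  have hb : BddAbove (Set.range fun n : ℕ => (n : U) * b) := ⟨c, by rintro _ ⟨n, rfl⟩; exact h n⟩
  have h1 : sSup (Set.range fun n : ℕ => (n : U) * b)
      ≤ sSup (Set.range fun n : ℕ => (n : U) * b) - b := by
    refine csSup_le (Set.range_nonempty _) ?_
    rintro _ ⟨n, rfl⟩
    have := le_csSup hb ⟨n + 1, rfl⟩
    push_cast at this
    rw [add_mul, one_mul] at this
    exact le_sub_iff_add_le.2 this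
  simpa using h1

/-- The square of any element of an `f`-algebra is positive. -/
lemma mul_self_nonneg_of_disjoint (hd : ∀ x y : U, x ⊓ y = 0 → x * y = 0) (x : U) :
    0 ≤ x * x := by
  have h : x⁺ * x⁻ = 0 := hd _ _ (posPart_inf_negPart_eq_zero x)
  have h2 : x * x = x⁺ * x⁺ + x⁻ * x⁻ := by
    have := posPart_sub_negPart x
    linear_combination (x + x⁺ - x⁻) * (-this) - 2 * h
  rw [h2]
  exact add_nonneg (mul_nonneg (posPart_nonneg x) (posPart_nonneg x))
    (mul_nonneg (negPart_nonneg x) (negPart_nonneg x))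

lemma mul_posPart_eq (hd : ∀ x y : U, x ⊓ y = 0 → x * y = 0) (x : U) : x * x⁺ = x⁺ * x⁺ := by
  have h : x⁺ * x⁻ = 0 := hd _ _ (posPart_inf_negPart_eq_zero x)
  have := posPart_sub_negPart x
  linear_combination (-x⁺) * this - h

/-- A unital Dedekind complete `f`-algebra is semiprime. -/
lemma eq_zero_of_mul_self_eq_zero (hd : ∀ x y : U, x ⊓ y = 0 → x * y = 0) {x : U}
    (h : x * x = 0) : x = 0 := by
  have key : ∀ y : U, y * y = 0 → y ≤ 0 := by
    intro y hy
    have h2 : y + y ≤ 0 := by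
      refine nonpos_of_forall_natCast_mul_le (c := 1) fun n => ?_
      have h1 := mul_self_nonneg_of_disjoint hd (1 - n * y)
      linear_combination h1 + (n : U) ^ 2 * hy
    have h3 : 0 ≤ -y := nsmul_two_semiclosed (by rw [two_nsmul]; linear_combination h2)
    simpa using h3
  refine le_antisymm (key x h) ?_
  have := key (-x) (by simpa using h)
  simpa using this

lemma eq_zero_of_mul_self_nonpos (hd : ∀ x y : U, x ⊓ y = 0 → x * y = 0) {x : U}
    (h : x * x ≤ 0) : x = 0 :=
  eq_zero_of_mul_self_eq_zero hd (le_antisymm h (mul_self_nonneg_of_disjoint hd x))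

lemma nonpos_of_mul_nonpos (hd : ∀ x y : U, x ⊓ y = 0 → x * y = 0) {z v : U}
    (hz : z * v ≤ 0) (hv : z⁺ ≤ v) : z ≤ 0 := by
  have h0 := posPart_nonneg z
  have h1 := mul_posPart_eq hd z
  have h2 : z⁺ * z⁺ * z⁺ ≤ 0 := by
    have h3 := mul_le_mul_of_nonneg_left hv (mul_nonneg h0 h0)
    have h4 := mul_le_mul_of_nonneg_left hz h0
    linear_combination h3 + h4 - v * h1
  have h5 : z⁺ * z⁺ = 0 := by
    refine eq_zero_of_mul_self_nonpos hd ?_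
    have := mul_le_mul_of_nonneg_left h2 h0
    linear_combination this
  exact posPart_eq_zero.1 (eq_zero_of_mul_self_eq_zero hd h5)

lemma nonpos_of_mul_nonpos_of_one_le (hd : ∀ x y : U, x ⊓ y = 0 → x * y = 0) {z v : U}
    (hz : z * v ≤ 0) (hv : 1 ≤ v) : z ≤ 0 := by
  have h0 := posPart_nonneg z
  have h1 := mul_posPart_eq hd z
  have h2 : z⁺ * z⁺ ≤ 0 := by
    have h3 := mul_le_mul_of_nonneg_left hv (mul_nonneg h0 h0)
    have h4 := mul_le_mul_of_nonneg_left hz h0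
    linear_combination h3 + h4 - v * h1
  exact posPart_eq_zero.1 (eq_zero_of_mul_self_nonpos hd h2)

lemma le_of_mul_self_le_mul (hd : ∀ x y : U, x ⊓ y = 0 → x * y = 0) {a k : U}
    (ha : 0 ≤ a) (hk : 0 ≤ k) (h : a * a ≤ k * a) : a ≤ k := by
  have h1 : (a - k)⁺ ≤ a := by
    rw [posPart_def]
    exact sup_le (by linear_combination hk) ha
  have := nonpos_of_mul_nonpos hd (z := a - k) (by linear_combination h) h1
  linear_combination this

lemma le_of_mul_self_le_mul_self (hd : ∀ x y : U, x ⊓ y = 0 → x * y = 0) {a b : U}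
    (ha : 0 ≤ a) (hb : 0 ≤ b) (h : a * a ≤ b * b) : a ≤ b := by
  have h1 : (a - b)⁺ ≤ a + b := by
    rw [posPart_def]
    exact sup_le (by linear_combination hb + hb) (add_nonneg ha hb)
  have := nonpos_of_mul_nonpos hd (z := a - b) (by linear_combination h) h1
  linear_combination this

lemma natCast_mul_posPart_sub_le (hd : ∀ x y : U, x ⊓ y = 0 → x * y = 0) {a : U} (ha : 0 ≤ a)
    (n : ℕ) : n * (a - n)⁺ ≤ a * a := by
  have h1 := mul_posPart_eq hd (a - n)
  have h0 := posPart_nonneg (a - (n : U))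
  have h2 : (a - n)⁺ ≤ a := by
    rw [posPart_def]
    exact sup_le (by simp) ha
  have h3 := mul_le_mul_of_nonneg_left h2 ha
  linear_combination h3 + mul_self_nonneg_of_disjoint hd (a - n)⁺ - h1

lemma DecreasesToZero.nonpos_of_le_natCast_mul {S : Set U} (h : DecreasesToZero S) (m : ℕ) :
    ∀ b, (∀ x ∈ S, b ≤ m * x) → b ≤ 0 := by
  obtain ⟨⟨p₀, hp₀⟩, hdir, h0, hinf⟩ := h
  induction m with
  | zero => intro b hb; simpa using hb p₀ hp₀
  | succ m ih =>
    refine fun b hb => hinf b fun p hp => ?_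
    have : b - p ≤ 0 := by
      refine ih _ fun q hq => ?_
      obtain ⟨r, hr, hrp, hrq⟩ := hdir p hp q hq
      have h1 := hb r hr
      have h2 := mul_le_mul_of_nonneg_left hrq (Nat.cast_nonneg (α := U) m)
      push_cast at h1
      linear_combination h1 + h2 + hrp
    linear_combination this

/-- Multiplication by a positive element is order continuous. -/
lemma DecreasesToZero.mul_left (hd : ∀ x y : U, x ⊓ y = 0 → x * y = 0) {S : Set U}
    (h : DecreasesToZero S) {a : U} (ha : 0 ≤ a) : DecreasesToZero ((a * ·) '' S) := by
  have h' := h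
  obtain ⟨⟨p₀, hp₀⟩, hdir, h0, hinf⟩ := h'
  refine ⟨⟨_, p₀, hp₀, rfl⟩, ?_, ?_, fun b hb => ?_⟩
  · rintro _ ⟨x, hx, rfl⟩ _ ⟨y, hy, rfl⟩
    obtain ⟨z, hz, hzx, hzy⟩ := hdir x hx y hy
    exact ⟨_, ⟨z, hz, rfl⟩, mul_le_mul_of_nonneg_left hzx ha, mul_le_mul_of_nonneg_left hzy ha⟩
  · rintro _ ⟨x, hx, rfl⟩
    exact mul_nonneg ha (h0 x hx)
  · refine nonpos_of_forall_natCast_mul_le (c := a * a * p₀) fun n => ?_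
    have hn : (0 : U) ≤ n := Nat.cast_nonneg n
    have : n * b - a * a * p₀ ≤ 0 := by
      refine h.nonpos_of_le_natCast_mul (n * n) _ fun q hq => ?_
      obtain ⟨r, hr, hrp, hrq⟩ := hdir p₀ hp₀ q hq
      have h1 := mul_le_mul_of_nonneg_left (hb _ ⟨r, hr, rfl⟩) hn
      have h2 := mul_le_mul_of_nonneg_right (natCast_mul_posPart_sub_le hd ha n) (h0 p₀ hp₀)
      have h3 := mul_le_mul_of_nonneg_left hrp (mul_nonneg hn (posPart_nonneg (a - (n : U))))
      have h4 := mul_le_mul_of_nonneg_left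
        (mul_le_mul_of_nonneg_right (le_posPart (a - (n : U))) (h0 r hr)) hn
      have h5 := mul_le_mul_of_nonneg_left hrq (mul_nonneg hn hn)
      push_cast
      linear_combination h1 + h2 + h3 + h4 + h5
    linear_combination this

lemma decreasesToZero_sub_of_isLUB {C : Set U} {c : U} (hne : C.Nonempty)
    (hC : DirectedOn (· ≤ ·) C) (h : IsLUB C c) : DecreasesToZero ((c - ·) '' C) := by
  obtain ⟨x₀, hx₀⟩ := hne
  refine ⟨⟨_, x₀, hx₀, rfl⟩, ?_, ?_, fun b hb => ?_⟩
  · rintro _ ⟨x, hx, rfl⟩ _ ⟨y, hy, rfl⟩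
    obtain ⟨z, hz, hzx, hzy⟩ := hC x hx y hy
    exact ⟨_, ⟨z, hz, rfl⟩, sub_le_sub_left hzx c, sub_le_sub_left hzy c⟩
  · rintro _ ⟨x, hx, rfl⟩
    exact sub_nonneg.2 (h.1 hx)
  · have : c ≤ c - b := h.2 fun x hx => by
      have := hb _ ⟨x, hx, rfl⟩
      linear_combination this
    linear_combination this

lemma decreasesToZero_truncation (hd : ∀ x y : U, x ⊓ y = 0 → x * y = 0) {g : U} (hg : 0 ≤ g) :
    DecreasesToZero (Set.range fun n : ℕ => (g - n)⁺) := by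
  have hmono : ∀ m n : ℕ, m ≤ n → (g - n)⁺ ≤ (g - m)⁺ := fun m n h =>
    posPart_mono (sub_le_sub_left (Nat.mono_cast h) g)
  refine ⟨Set.range_nonempty _, ?_, ?_, fun b hb => ?_⟩
  · rintro _ ⟨m, rfl⟩ _ ⟨n, rfl⟩
    exact ⟨_, ⟨max m n, rfl⟩, hmono _ _ (le_max_left m n), hmono _ _ (le_max_right m n)⟩
  · rintro _ ⟨n, rfl⟩
    exact posPart_nonneg _
  · refine nonpos_of_forall_natCast_mul_le (c := g * g) fun n => ?_
    exact (mul_le_mul_of_nonneg_left (hb _ ⟨n, rfl⟩) (Nat.cast_nonneg n)).trans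
      (natCast_mul_posPart_sub_le hd hg n)

end FAlgebra

namespace CESetup

open FAlgebra

variable {U : Type*} [CommRing U] [ConditionallyCompleteLattice U]
  [CovariantClass U U (· + ·) (· ≤ ·)] [Module ℝ U] [PosSMulMono ℝ U]

lemma isOrderedRing (s : CESetup U) : IsOrderedRing U where
  add_le_add_left a b h c := by
    simpa [add_comm] using CovariantClass.elim (μ := (· + ·)) (r := (· ≤ ·)) c h
  zero_le_one := s.one_pos.le
  mul_le_mul_of_nonneg_left a ha b c h := by
    have := s.mul_nonneg a (c - b) ha (by
      simpa using CovariantClass.elim (μ := (· + ·)) (r := (· ≤ ·)) (-b) h)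
    have h2 := CovariantClass.elim (μ := (· + ·)) (r := (· ≤ ·)) (a * b) this
    simpa [mul_sub] using h2
  mul_le_mul_of_nonneg_right a ha b c h := by
    have := s.mul_nonneg a (c - b) ha (by
      simpa using CovariantClass.elim (μ := (· + ·)) (r := (· ≤ ·)) (-b) h)
    have h2 := CovariantClass.elim (μ := (· + ·)) (r := (· ≤ ·)) (a * b) this
    simpa [mul_sub, mul_comm] using h2

lemma mul_eq_zero_of_inf_eq_zero (s : CESetup U) (x y : U) (h : x ⊓ y = 0) : x * y = 0 := by
  have hx : 0 ≤ x := h ▸ inf_le_left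
  have hy : 0 ≤ y := h ▸ inf_le_right
  have h1 := s.falg y (x * y) x (by rw [inf_comm]; exact s.falg x y y h hy) hx
  rwa [mul_comm y x, inf_idem] at h1

lemma L1_neg (s : CESetup U) {x : U} (hx : x ∈ s.L1) : -x ∈ s.L1 :=
  s.L1_ideal _ x hx (abs_neg x).le

lemma L1_sub (s : CESetup U) {x y : U} (hx : x ∈ s.L1) (hy : y ∈ s.L1) : x - y ∈ s.L1 :=
  sub_eq_add_neg x y ▸ s.L1_add x hx _ (s.L1_neg hy)

lemma T_sub (s : CESetup U) {x y : U} (hx : x ∈ s.L1) (hy : y ∈ s.L1) :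
    s.T (x - y) = s.T x - s.T y := by
  have h := s.T_add (x - y) (s.L1_sub hx hy) y hy
  rw [sub_add_cancel] at h
  linear_combination -h

lemma T_nonpos_of_le (s : CESetup U) {S : Set U} (hS : S ⊆ s.L1) (h : DecreasesToZero S) {b : U}
    (hb : ∀ x ∈ S, b ≤ s.T x) : b ≤ 0 := by
  rw [← s.T_ordCont S hS h.1 h.2.1 h.2.2.1 h.sInf_eq]
  exact le_csInf (h.1.image _) (by rintro _ ⟨x, hx, rfl⟩; exact hb x hx)

lemma RT_natCast (s : CESetup U) (n : ℕ) : (n : U) ∈ s.RT := by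
  induction n with
  | zero => simpa using s.RT_zero
  | succ n ih => push_cast; exact s.RT_add _ ih _ s.RT_one

lemma RT_inf (s : CESetup U) {x y : U} (hx : x ∈ s.RT) (hy : y ∈ s.RT) : x ⊓ y ∈ s.RT := by
  have h := s.RT_neg _ (s.RT_sup _ (s.RT_neg x hx) _ (s.RT_neg y hy))
  rwa [neg_sup, neg_neg, neg_neg] at h

lemma L2_neg (s : CESetup U) {f : U} (hf : f ∈ s.L2) : -f ∈ s.L2 :=
  ⟨s.L1_neg hf.1, by simpa using hf.2⟩

lemma RT_mul_L2 (s : CESetup U) {r f : U} (hr : r ∈ s.RT) (hf : f ∈ s.L2) : r * f ∈ s.L2 := by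
  refine ⟨s.L1_module r hr f hf.1, ?_⟩
  rw [mul_mul_mul_comm]
  exact s.L1_module _ (s.RT_mul r hr r hr) _ hf.2

lemma L2_one (s : CESetup U) : (1 : U) ∈ s.L2 := ⟨s.L1_one, by simpa using s.L1_one⟩

lemma norm2_nonneg (s : CESetup U) (f : U) : 0 ≤ s.norm2 f := s.sqrt_nonneg _

variable [IsOrderedRing U]

lemma mul_self_nonneg (s : CESetup U) (x : U) : 0 ≤ x * x :=
  mul_self_nonneg_of_disjoint s.mul_eq_zero_of_inf_eq_zero x

lemma L1_of_le_of_le (s : CESetup U) {x y : U} (hy : y ∈ s.L1) (h1 : -y ≤ x) (h2 : x ≤ y) :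
    x ∈ s.L1 :=
  s.L1_ideal x y hy ((abs_le'.2 ⟨h2, by linear_combination h1⟩).trans (le_abs_self y))

lemma L1_of_nonneg_of_le (s : CESetup U) {x y : U} (hy : y ∈ s.L1) (h1 : 0 ≤ x) (h2 : x ≤ y) :
    x ∈ s.L1 :=
  s.L1_of_le_of_le hy (by linear_combination h1 + h1 + h2) h2

lemma T_mono (s : CESetup U) {x y : U} (hx : x ∈ s.L1) (hy : y ∈ s.L1) (h : x ≤ y) :
    s.T x ≤ s.T y := by
  have h1 := s.T_pos (y - x) (s.L1_sub hy hx) (sub_nonneg.2 h)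
  rw [s.T_sub hy hx] at h1
  linear_combination h1

lemma mul_mem_L1 (s : CESetup U) {f g : U} (hf : f ∈ s.L2) (hg : g ∈ s.L2) : f * g ∈ s.L1 := by
  have hf2 := s.mul_self_nonneg f
  have hg2 := s.mul_self_nonneg g
  refine s.L1_of_le_of_le (s.L1_add _ hf.2 _ hg.2) ?_ ?_
  · rw [← sub_nonneg]
    refine nsmul_two_semiclosed ?_
    rw [two_nsmul]
    linear_combination s.mul_self_nonneg (f + g) + hf2 + hg2
  · rw [← sub_nonneg]
    refine nsmul_two_semiclosed ?_
    rw [two_nsmul]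
    linear_combination s.mul_self_nonneg (f - g) + hf2 + hg2

lemma L2_add (s : CESetup U) {f g : U} (hf : f ∈ s.L2) (hg : g ∈ s.L2) : f + g ∈ s.L2 := by
  have hfg := s.mul_mem_L1 hf hg
  refine ⟨s.L1_add _ hf.1 _ hg.1, ?_⟩
  have := s.L1_add _ (s.L1_add _ hf.2 _ hfg) _ (s.L1_add _ hfg _ hg.2)
  convert this using 1
  ring

lemma L2_sub (s : CESetup U) {f g : U} (hf : f ∈ s.L2) (hg : g ∈ s.L2) : f - g ∈ s.L2 :=
  sub_eq_add_neg f g ▸ s.L2_add hf (s.L2_neg hg)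

lemma L2_of_nonneg_of_le (s : CESetup U) {f g : U} (hg : g ∈ s.L2) (h0 : 0 ≤ f) (h : f ≤ g) :
    f ∈ s.L2 :=
  ⟨s.L1_of_nonneg_of_le hg.1 h0 h, s.L1_of_nonneg_of_le hg.2 (_root_.mul_nonneg h0 h0)
    (mul_le_mul h h h0 (h0.trans h))⟩

lemma posPart_mem_L2 (s : CESetup U) {f : U} (hf : f ∈ s.L2) : f⁺ ∈ s.L2 := by
  have h0 := posPart_nonneg f
  have h1 := negPart_nonneg f
  have h : f⁺ * f⁻ = 0 := s.mul_eq_zero_of_inf_eq_zero _ _ (posPart_inf_negPart_eq_zero f)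
  refine ⟨s.L1_ideal _ f hf.1 ?_, s.L1_of_nonneg_of_le hf.2 (_root_.mul_nonneg h0 h0) ?_⟩
  · rw [abs_of_nonneg h0, posPart_def]
    exact sup_le (le_abs_self f) (abs_nonneg f)
  · have := posPart_sub_negPart f
    linear_combination (f + f⁺ - f⁻) * this + h + h + _root_.mul_nonneg h1 h1

lemma negPart_mem_L2 (s : CESetup U) {f : U} (hf : f ∈ s.L2) : f⁻ ∈ s.L2 := by
  have := s.posPart_mem_L2 (s.L2_neg hf)
  rwa [posPart_neg] at this

lemma abs_mem_L2 (s : CESetup U) {f : U} (hf : f ∈ s.L2) : |f| ∈ s.L2 := by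
  rw [← posPart_add_negPart]
  exact s.L2_add (s.posPart_mem_L2 hf) (s.negPart_mem_L2 hf)

lemma norm2_mul_self (s : CESetup U) {f : U} (hf : f ∈ s.L2) :
    s.norm2 f * s.norm2 f = s.T (f * f) :=
  s.sqrt_sq _ (s.T_pos _ hf.2 (s.mul_self_nonneg f))

lemma norm2_mem_RT (s : CESetup U) {f : U} (hf : f ∈ s.L2) : s.norm2 f ∈ s.RT :=
  s.sqrt_mem _ (s.T_mem _ hf.2) (s.T_pos _ hf.2 (s.mul_self_nonneg f))

lemma norm2_mono (s : CESetup U) {f g : U} (hg : g ∈ s.L2) (h0 : 0 ≤ f) (h : f ≤ g) :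
    s.norm2 f ≤ s.norm2 g := by
  have hf := s.L2_of_nonneg_of_le hg h0 h
  refine le_of_mul_self_le_mul_self s.mul_eq_zero_of_inf_eq_zero (s.norm2_nonneg f)
    (s.norm2_nonneg g) ?_
  rw [s.norm2_mul_self hf, s.norm2_mul_self hg]
  exact s.T_mono hf.2 hg.2 (mul_le_mul h h h0 (h0.trans h))

lemma T_mul_le (s : CESetup U) {f g : U} (hf : f ∈ s.L2) (hg : g ∈ s.L2) :
    s.T (f * g) ≤ s.norm2 f * s.norm2 g := by
  have hd := s.mul_eq_zero_of_inf_eq_zero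
  have hα0 := s.norm2_nonneg f
  have hγ0 := s.norm2_nonneg g
  have hα := s.norm2_mem_RT hf
  have hγ := s.norm2_mem_RT hg
  have hα2 := s.norm2_mul_self hf
  have hγ2 := s.norm2_mul_self hg
  set α := s.norm2 f
  set γ := s.norm2 g
  set X := s.T (f * g) with hX
  have hfg := s.mul_mem_L1 hf hg
  have key : ∀ a ∈ s.RT, ∀ c ∈ s.RT,
      c * a * X + c * a * X ≤ c * c * (α * α) + a * a * (γ * γ) := by
    intro a ha c hc
    have hac := s.RT_mul c hc a ha
    have hcc := s.RT_mul c hc c hc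
    have haa := s.RT_mul a ha a ha
    rw [hα2, hγ2, hX, ← s.T_avg _ hac _ hfg, ← s.T_avg _ hcc _ hf.2, ← s.T_avg _ haa _ hg.2,
      ← s.T_add _ (s.L1_module _ hac _ hfg) _ (s.L1_module _ hac _ hfg),
      ← s.T_add _ (s.L1_module _ hcc _ hf.2) _ (s.L1_module _ haa _ hg.2)]
    refine s.T_mono (s.L1_add _ (s.L1_module _ hac _ hfg) _ (s.L1_module _ hac _ hfg))
      (s.L1_add _ (s.L1_module _ hcc _ hf.2) _ (s.L1_module _ haa _ hg.2)) ?_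
    linear_combination s.mul_self_nonneg (c * f - a * g)
  have step : ∀ n : ℕ, (n : U) * n * X ≤ (n * α + 1) * (n * γ + 1) := by
    intro n
    have hn : (0 : U) ≤ n := Nat.cast_nonneg n
    have hnα := _root_.mul_nonneg hn hα0
    have hnγ := _root_.mul_nonneg hn hγ0
    have h1 := mul_le_mul_of_nonneg_left (key (n * α + 1)
      (s.RT_add _ (s.RT_mul _ (s.RT_natCast n) _ hα) _ s.RT_one) (n * γ + 1)
      (s.RT_add _ (s.RT_mul _ (s.RT_natCast n) _ hγ) _ s.RT_one)) (_root_.mul_nonneg hn hn)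
    have ha1 : (1 : U) ≤ n * α + 1 := by linear_combination hnα
    have hc1 : (1 : U) ≤ n * γ + 1 := by linear_combination hnγ
    have ha0 : (0 : U) ≤ n * α + 1 := zero_le_one.trans ha1
    have hc0 : (0 : U) ≤ n * γ + 1 := zero_le_one.trans hc1
    have ha2 : n * α * (n * α) ≤ (n * α + 1) * (n * α + 1) := by
      linear_combination hnα + ha1
    have hc2 : n * γ * (n * γ) ≤ (n * γ + 1) * (n * γ + 1) := by
      linear_combination hnγ + hc1
    have h2 := mul_le_mul_of_nonneg_left ha2 (_root_.mul_nonneg hc0 hc0)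
    have h3 := mul_le_mul_of_nonneg_left hc2 (_root_.mul_nonneg ha0 ha0)
    have hu1 : (1 : U) ≤ (n * γ + 1) * (n * α + 1) := one_le_mul_of_one_le_of_one_le hc1 ha1
    rw [← sub_nonpos]
    refine nonpos_of_mul_nonpos_of_one_le hd (v := (n * γ + 1) * (n * α + 1)) ?_ hu1
    rw [← neg_nonneg]
    refine nsmul_two_semiclosed ?_
    rw [two_nsmul]
    linear_combination h1 + h2 + h3
  rw [← sub_nonpos]
  refine nonpos_of_forall_natCast_mul_le (c := α + γ + 1) fun n => ?_
  rcases Nat.eq_zero_or_pos n with rfl | hn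
  · simpa using add_nonneg (add_nonneg hα0 hγ0) zero_le_one
  · have hn1 : (1 : U) ≤ n := by simpa using Nat.mono_cast (α := U) hn
    rw [← sub_nonpos]
    refine nonpos_of_mul_nonpos_of_one_le hd (v := n) ?_ hn1
    linear_combination step n + hn1

lemma abs_T_mul_le (s : CESetup U) {f g : U} (hf : f ∈ s.L2) (hg : g ∈ s.L2) :
    |s.T (f * g)| ≤ s.norm2 f * s.norm2 g := by
  refine abs_le'.2 ⟨s.T_mul_le hf hg, ?_⟩
  have h := s.T_mul_le (s.L2_neg hf) hg
  have h1 := s.T_sub s.L1_zero (s.mul_mem_L1 hf hg)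
  have h2 := s.T_fix 0 s.RT_zero
  simp only [norm2, neg_mul_neg] at h
  rw [zero_sub, h2, zero_sub, ← neg_mul] at h1
  rw [h1] at h
  exact h

end CESetup

namespace CESetup

open FAlgebra

namespace IsTLinear

variable {U : Type*} [CommRing U] [ConditionallyCompleteLattice U]
  [CovariantClass U U (· + ·) (· ≤ ·)] [Module ℝ U] [PosSMulMono ℝ U]
  {s : CESetup U} {F G : U → U}

lemma map_neg (hF : s.IsTLinear F) {f : U} (hf : f ∈ s.L2) : F (-f) = -F f := by
  have := hF.2.2.1 (-1) (s.RT_neg 1 s.RT_one) f hf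
  simpa using this

lemma map_sub (hF : s.IsTLinear F) {f g : U} (hf : f ∈ s.L2) (hg : g ∈ s.L2) :
    F (f - g) = F f - F g := by
  rw [sub_eq_add_neg, hF.2.1 f hf _ (s.L2_neg hg), hF.map_neg hg, sub_eq_add_neg]

lemma map_zero (hF : s.IsTLinear F) : F 0 = 0 := by
  simpa using hF.2.2.1 0 s.RT_zero 1 s.L2_one

lemma neg (hF : s.IsTLinear F) : s.IsTLinear (fun g => -F g) := by
  refine ⟨fun f hf => s.RT_neg _ (hF.1 f hf), fun f hf g hg => ?_, fun r hr f hf => ?_,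
    fun S hS hne hdir h0 hinf => ?_⟩
  · beta_reduce
    rw [hF.2.1 f hf g hg, neg_add]
  · beta_reduce
    rw [hF.2.2.1 r hr f hf, mul_neg]
  · simpa only [abs_neg] using hF.2.2.2 S hS hne hdir h0 hinf

lemma nonpos_of_le (hF : s.IsTLinear F) {S : Set U} (hS : S ⊆ s.L2) (h : DecreasesToZero S)
    {b : U} (hb : ∀ x ∈ S, b ≤ F x) : b ≤ 0 := by
  obtain ⟨w, -, hinf, hw⟩ := hF.2.2.2 S hS h.1 h.2.1 h.2.2.1 h.sInf_eq
  rw [← hinf]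
  refine le_csInf (h.1.image _) ?_
  rintro _ ⟨x, hx, rfl⟩
  exact (hb x hx).trans ((le_abs_self _).trans (hw x hx))

variable [IsOrderedRing U]

lemma comp_mul (hF : s.IsTLinear F) {a : U} (ha : 0 ≤ a) (haL : ∀ g ∈ s.L2, a * g ∈ s.L2) :
    s.IsTLinear (fun g => F (a * g)) := by
  refine ⟨fun f hf => hF.1 _ (haL f hf), fun f hf g hg => ?_, fun r hr f hf => ?_,
    fun S hS hne hdir h0 hinf => ?_⟩
  · beta_reduce
    rw [mul_add, hF.2.1 _ (haL f hf) _ (haL g hg)]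
  · beta_reduce
    rw [mul_left_comm, hF.2.2.1 r hr _ (haL f hf)]
  · have hS' := (DecreasesToZero.of_sInf hne hdir h0 hinf).mul_left
      s.mul_eq_zero_of_inf_eq_zero ha
    have hL : (a * ·) '' S ⊆ s.L2 := by
      rintro _ ⟨x, hx, rfl⟩
      exact haL x (hS hx)
    obtain ⟨w, hmono, hw0, hw⟩ := hF.2.2.2 _ hL hS'.1 hS'.2.1 hS'.2.2.1 hS'.sInf_eq
    refine ⟨fun p => w (a * p), fun p hp q hq hpq => ?_, ?_, fun p hp => hw _ ⟨p, hp, rfl⟩⟩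
    · exact hmono _ ⟨p, hp, rfl⟩ _ ⟨q, hq, rfl⟩ (mul_le_mul_of_nonneg_left hpq ha)
    · rwa [Set.image_image] at hw0

lemma sub (hF : s.IsTLinear F) (hG : s.IsTLinear G) : s.IsTLinear (fun g => F g - G g) := by
  refine ⟨fun f hf => ?_, fun f hf g hg => ?_, fun r hr f hf => ?_,
    fun S hS hne hdir h0 hinf => ?_⟩
  · beta_reduce
    rw [sub_eq_add_neg]
    exact s.RT_add _ (hF.1 f hf) _ (s.RT_neg _ (hG.1 f hf))
  · beta_reduce
    rw [hF.2.1 f hf g hg, hG.2.1 f hf g hg]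
    ring
  · beta_reduce
    rw [hF.2.2.1 r hr f hf, hG.2.2.1 r hr f hf]
    ring
  · obtain ⟨v, hv, hv0, hFv⟩ := hF.2.2.2 S hS hne hdir h0 hinf
    obtain ⟨w, hw, hw0, hGw⟩ := hG.2.2.2 S hS hne hdir h0 hinf
    refine ⟨fun p => v p + w p, fun p hp q hq hpq => add_le_add (hv p hp q hq hpq)
      (hw p hp q hq hpq), ?_, fun p hp => ?_⟩
    · refine sInf_eq_zero_of_forall (hne.image _) ?_ fun b hb => ?_
      · rintro _ ⟨p, hp, rfl⟩
        exact add_nonneg ((abs_nonneg _).trans (hFv p hp)) ((abs_nonneg _).trans (hGw p hp))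
      · rw [← hw0]
        refine le_csInf (hne.image _) ?_
        rintro _ ⟨q, hq, rfl⟩
        have : b - w q ≤ 0 := by
          rw [← hv0]
          refine le_csInf (hne.image _) ?_
          rintro _ ⟨p, hp, rfl⟩
          obtain ⟨r, hr, hrp, hrq⟩ := hdir p hp q hq
          have h1 := hb _ ⟨r, hr, rfl⟩
          have h2 := hv r hr p hp hrp
          have h3 := hw r hr q hq hrq
          linear_combination h1 + h2 + h3
        linear_combination this
    · have h1 := abs_le'.1 (hFv p hp)
      have h2 := abs_le'.1 (hGw p hp)
      exact abs_le'.2 ⟨by linear_combination h1.1 + h2.2, by linear_combination h1.2 + h2.1⟩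

lemma of_mul_left {f : U} (hf : f ∈ s.L2) : s.IsTLinear (fun g => s.T (f * g)) := by
  refine ⟨fun g hg => s.T_mem _ (s.mul_mem_L1 hf hg), fun g hg h hh => ?_, fun r hr g hg => ?_,
    fun S hS hne hdir h0 hinf => ?_⟩
  · beta_reduce
    rw [mul_add, s.T_add _ (s.mul_mem_L1 hf hg) _ (s.mul_mem_L1 hf hh)]
  · beta_reduce
    rw [mul_left_comm, s.T_avg r hr _ (s.mul_mem_L1 hf hg)]
  · have hf' := s.abs_mem_L2 hf
    have hS' := (DecreasesToZero.of_sInf hne hdir h0 hinf).mul_left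
      s.mul_eq_zero_of_inf_eq_zero (abs_nonneg f)
    refine ⟨fun p => s.T (|f| * p), fun p hp q hq hpq => ?_, ?_, fun p hp => ?_⟩
    · exact s.T_mono (s.mul_mem_L1 hf' (hS hp)) (s.mul_mem_L1 hf' (hS hq))
        (mul_le_mul_of_nonneg_left hpq (abs_nonneg f))
    · refine sInf_eq_zero_of_forall (hne.image _) ?_ fun b hb => ?_
      · rintro _ ⟨p, hp, rfl⟩
        exact s.T_pos _ (s.mul_mem_L1 hf' (hS hp))
          (_root_.mul_nonneg (abs_nonneg f) (h0 p hp))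
      · refine s.T_nonpos_of_le ?_ hS' (b := b) ?_
        · rintro _ ⟨p, hp, rfl⟩
          exact s.mul_mem_L1 hf' (hS hp)
        · rintro _ ⟨p, hp, rfl⟩
          exact hb _ ⟨p, hp, rfl⟩
    · have h1 := s.T_mono (s.mul_mem_L1 hf (hS hp)) (s.mul_mem_L1 hf' (hS hp))
        (mul_le_mul_of_nonneg_right (le_abs_self f) (h0 p hp))
      have h2 := s.T_mono (s.mul_mem_L1 (s.L2_neg hf) (hS hp)) (s.mul_mem_L1 hf' (hS hp))
        (mul_le_mul_of_nonneg_right (neg_le_abs f) (h0 p hp))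
      have h3 := s.T_sub s.L1_zero (s.mul_mem_L1 hf (hS hp))
      rw [zero_sub, s.T_fix 0 s.RT_zero, zero_sub, ← neg_mul] at h3
      exact abs_le'.2 ⟨h1, h3 ▸ h2⟩

/-- Values of a `T`-linear functional at the supremum of an increasing family. -/
lemma le_of_isLUB (hF : s.IsTLinear F) {C : Set U} {c b : U} (hCL : C ⊆ s.L2) (hc : c ∈ s.L2)
    (hne : C.Nonempty) (hC : DirectedOn (· ≤ ·) C) (h : IsLUB C c) (hb : ∀ x ∈ C, F x ≤ b) :
    F c ≤ b := by
  rw [← sub_nonpos]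
  refine hF.nonpos_of_le (S := (c - ·) '' C) ?_ (decreasesToZero_sub_of_isLUB hne hC h) ?_
  · rintro _ ⟨x, hx, rfl⟩
    exact s.L2_sub hc (hCL hx)
  · rintro _ ⟨x, hx, rfl⟩
    rw [hF.map_sub hc (hCL hx)]
    linear_combination hb x hx

/-- A functional that is not negative at `u` is positive on some nontrivial interval `[0, P]`
with `P ≤ u`. -/
lemma exists_forall_nonneg (hF : s.IsTLinear F) {u : U} (hu : u ∈ s.L2) (hu0 : 0 ≤ u)
    (hFu : ¬ F u ≤ 0) :
    ∃ P, 0 ≤ P ∧ P ≤ u ∧ P ≠ 0 ∧ ∀ c, 0 ≤ c → c ≤ P → 0 ≤ F c := by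
  have hL : ∀ {x}, 0 ≤ x → x ≤ u → x ∈ s.L2 := fun h0 h1 => s.L2_of_nonneg_of_le hu h0 h1
  obtain ⟨h, -, ⟨hh0, hhu, hFh⟩, hmax⟩ := zorn_le_nonempty₀ {x | 0 ≤ x ∧ x ≤ u ∧ F x ≤ 0}
    (fun C hC hchain y hy => by
      have hlub : IsLUB C (sSup C) := isLUB_csSup ⟨y, hy⟩ ⟨u, fun x hx => (hC hx).2.1⟩
      have h0 : 0 ≤ sSup C := (hC hy).1.trans (hlub.1 hy)
      have h1 : sSup C ≤ u := hlub.2 fun x hx => (hC hx).2.1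
      exact ⟨sSup C, ⟨h0, h1, hF.le_of_isLUB (fun x hx => hL (hC hx).1 (hC hx).2.1) (hL h0 h1)
        ⟨y, hy⟩ hchain.directedOn hlub fun x hx => (hC hx).2.2⟩, hlub.1⟩)
    0 ⟨le_rfl, hu0, hF.map_zero.le⟩
  refine ⟨u - h, sub_nonneg.2 hhu, by linear_combination hh0, fun h1 => ?_, fun c hc0 hcu => ?_⟩
  · rw [sub_eq_zero] at h1
    exact hFu (h1 ▸ hFh)
  have hcL : c ∈ s.L2 := hL hc0 (by linear_combination hcu + hh0)
  have ha : (F c)⁻ ∈ s.RT := by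
    rw [negPart_def]
    exact s.RT_sup _ (s.RT_neg _ (hF.1 c hcL)) _ s.RT_zero
  have ha0 := negPart_nonneg (F c)
  have hd := s.mul_eq_zero_of_inf_eq_zero
  have hdis := hd _ _ (posPart_inf_negPart_eq_zero (F c))
  have hdec := posPart_sub_negPart (F c)
  have hp0 := posPart_nonneg (F c)
  have hr := s.RT_inf ha s.RT_one
  have hra : (F c)⁻ ⊓ 1 ≤ (F c)⁻ := inf_le_left
  have hr1 : (F c)⁻ ⊓ 1 ≤ 1 := inf_le_right
  have hr0 : 0 ≤ (F c)⁻ ⊓ 1 := le_inf ha0 zero_le_one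
  set r := (F c)⁻ ⊓ 1 with hrdef
  have hrF : r * F c = -(r * (F c)⁻) := by
    have h1 := mul_le_mul_of_nonneg_right hra hp0
    have h2 : r * (F c)⁺ = 0 :=
      le_antisymm (by linear_combination h1 + hdis) (_root_.mul_nonneg hr0 hp0)
    linear_combination h2 - r * hdec
  have hrc0 : 0 ≤ r * c := _root_.mul_nonneg hr0 hc0
  have hrc1 : r * c ≤ c := mul_le_of_le_one_left hc0 hr1
  have hrcL : r * c ∈ s.L2 := s.RT_mul_L2 hr hcL
  have hle : h + r * c ≤ h := by
    refine hmax ⟨add_nonneg hh0 hrc0, by linear_combination hrc1 + hcu, ?_⟩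
      (by linear_combination hrc0)
    rw [hF.2.1 h (hL hh0 hhu) _ hrcL, hF.2.2.1 r hr c hcL, hrF]
    linear_combination hFh + _root_.mul_nonneg hr0 ha0
  have hrc : r * c = 0 := le_antisymm (by linear_combination hle) hrc0
  have hra' : r * (F c)⁻ = 0 := by
    have := hF.2.2.1 r hr c hcL
    rw [hrc, hF.map_zero, hrF] at this
    linear_combination this
  have hr' : r = 0 := by
    refine eq_zero_of_mul_self_nonpos hd ?_
    linear_combination mul_le_mul_of_nonneg_left hra hr0 + hra'
  exact negPart_eq_zero.1 (s.one_weak _ ha0 hr')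

/-- A functional that is positive on `[0, P]` is positive on all `P * g` with `g ≥ 0`. -/
lemma nonneg_mul (hF : s.IsTLinear F) {P : U} (hP0 : 0 ≤ P) (hP1 : P ≤ 1)
    (h : ∀ c, 0 ≤ c → c ≤ P → 0 ≤ F c) {g : U} (hg : g ∈ s.L2) (hg0 : 0 ≤ g) :
    0 ≤ F (P * g) := by
  have hnL : ∀ n : ℕ, (n : U) * P ∈ s.L2 := fun n =>
    s.RT_mul_L2 (s.RT_natCast n) (s.L2_of_nonneg_of_le s.L2_one hP0 hP1)
  have hPL : ∀ {x}, x ∈ s.L2 → 0 ≤ x → P * x ∈ s.L2 := fun hx hx0 =>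
    s.L2_of_nonneg_of_le hx (_root_.mul_nonneg hP0 hx0) (mul_le_of_le_one_left hx0 hP1)
  have bdd : ∀ n : ℕ, ∀ c, 0 ≤ c → c ≤ n * P → 0 ≤ F c := by
    intro n
    induction n with
    | zero => intro c hc hcn; exact h c hc (hcn.trans (by simpa using hP0))
    | succ n ih =>
      intro c hc hcn
      have hcL := s.L2_of_nonneg_of_le (hnL (n + 1)) hc hcn
      push_cast at hcn
      have h0 := posPart_nonneg (c - P)
      have h1 := le_posPart (c - P)
      have h2 : (c - P)⁺ ≤ c := by
        rw [posPart_def]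
        exact sup_le (by linear_combination hP0) hc
      have h3 : (c - P)⁺ ≤ n * P := by
        rw [posPart_def]
        exact sup_le (by linear_combination hcn) (_root_.mul_nonneg (Nat.cast_nonneg n) hP0)
      have h4 := ih _ h0 h3
      have h5 := h (c - (c - P)⁺) (sub_nonneg.2 h2) (by linear_combination h1)
      rw [hF.map_sub hcL (s.L2_of_nonneg_of_le hcL h0 h2)] at h5
      linear_combination h4 + h5
  rw [← neg_nonpos]
  have hd := s.mul_eq_zero_of_inf_eq_zero
  have htr : ∀ n : ℕ, (g - n)⁺ ≤ g := fun n => by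
    rw [posPart_def]
    exact sup_le (by simp) hg0
  have htL : ∀ n : ℕ, (g - n)⁺ ∈ s.L2 := fun n =>
    s.L2_of_nonneg_of_le hg (posPart_nonneg _) (htr n)
  refine hF.neg.nonpos_of_le (S := (P * ·) '' Set.range fun n : ℕ => (g - n)⁺) ?_
    ((decreasesToZero_truncation hd hg0).mul_left hd hP0) ?_
  · rintro _ ⟨_, ⟨n, rfl⟩, rfl⟩
    exact hPL (htL n) (posPart_nonneg _)
  · rintro _ ⟨_, ⟨n, rfl⟩, rfl⟩
    have h1 := bdd n (P * (g - (g - n)⁺)) (_root_.mul_nonneg hP0 (sub_nonneg.2 (htr n))) (by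
      have := mul_le_mul_of_nonneg_left (le_posPart (g - (n : U))) hP0
      linear_combination this)
    rw [mul_sub, hF.map_sub (hPL hg hg0) (hPL (htL n) (posPart_nonneg _))] at h1
    linear_combination h1

end IsTLinear

end CESetup

namespace CESetup

open FAlgebra

variable {U : Type*} [CommRing U] [ConditionallyCompleteLattice U]
  [CovariantClass U U (· + ·) (· ≤ ·)] [Module ℝ U] [PosSMulMono ℝ U] [IsOrderedRing U]
  {s : CESetup U} {F : U → U}

/-- Hahn decomposition of the unit with respect to a `T`-linear functional. -/
lemma IsTLinear.exists_hahn (hF : s.IsTLinear F) :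
    ∃ N, 0 ≤ N ∧ N ≤ 1 ∧ (∀ c, 0 ≤ c → c ≤ N → F c ≤ 0) ∧
      ∀ c, 0 ≤ c → c ≤ 1 - N → 0 ≤ F c := by
  have hL : ∀ {x : U}, 0 ≤ x → x ≤ 1 → x ∈ s.L2 := fun h0 h1 =>
    s.L2_of_nonneg_of_le s.L2_one h0 h1
  obtain ⟨N, -, ⟨hN0, hN1, hN⟩, hmax⟩ := zorn_le_nonempty₀
    {x : U | 0 ≤ x ∧ x ≤ 1 ∧ ∀ c, 0 ≤ c → c ≤ x → F c ≤ 0}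
    (fun C hC hchain y hy => by
      have hlub : IsLUB C (sSup C) := isLUB_csSup ⟨y, hy⟩ ⟨1, fun x hx => (hC hx).2.1⟩
      have h0 : 0 ≤ sSup C := (hC hy).1.trans (hlub.1 hy)
      have h1 : sSup C ≤ 1 := hlub.2 fun x hx => (hC hx).2.1
      refine ⟨sSup C, ⟨h0, h1, fun c hc0 hc => ?_⟩, hlub.1⟩
      have hcL := hL hc0 (hc.trans h1)
      have hlow : ∀ x ∈ C, (c - (sSup C - x))⁺ ≤ c := fun x hx => by
        rw [posPart_def]
        exact sup_le (by linear_combination hlub.1 hx) hc0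
      refine hF.le_of_isLUB (C := (fun x => (c - (sSup C - x))⁺) '' C) ?_ hcL
        ⟨_, y, hy, rfl⟩ ?_ ?_ ?_
      · rintro _ ⟨x, hx, rfl⟩
        exact s.L2_of_nonneg_of_le hcL (posPart_nonneg _)
          (hlow x hx)
      · rintro _ ⟨x, hx, rfl⟩ _ ⟨z, hz, rfl⟩
        obtain ⟨t, ht, hxt, hzt⟩ := hchain.directedOn x hx z hz
        exact ⟨_, ⟨t, ht, rfl⟩, posPart_mono (by linear_combination hxt),
          posPart_mono (by linear_combination hzt)⟩
      · refine ⟨?_, fun b hb => ?_⟩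
        · rintro _ ⟨x, hx, rfl⟩
          exact hlow x hx
        · have : sSup C ≤ b - c + sSup C := hlub.2 fun x hx => by
            have h2 := hb ⟨x, hx, rfl⟩
            have h3 := le_posPart (c - (sSup C - x))
            linear_combination h2 + h3
          linear_combination this
      · rintro _ ⟨x, hx, rfl⟩
        refine (hC hx).2.2 _ (posPart_nonneg _) ?_
        beta_reduce
        rw [posPart_def]
        exact sup_le (by linear_combination hc) (hC hx).1)
    0 ⟨le_rfl, zero_le_one, fun c h0 h1 => by rw [le_antisymm h1 h0, hF.map_zero]⟩
  refine ⟨N, hN0, hN1, hN, fun c hc0 hc => ?_⟩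
  by_contra hneg
  obtain ⟨P, hP0, hPc, hPne, hP⟩ := hF.neg.exists_forall_nonneg
    (hL hc0 (by linear_combination hc + hN0)) hc0 (by simpa using hneg)
  have hle : N + P ≤ N := by
    refine hmax ⟨add_nonneg hN0 hP0, by linear_combination hc + hPc, fun d hd0 hd => ?_⟩
      (by linear_combination hP0)
    have hdL : d ∈ s.L2 := hL hd0 (by linear_combination hd + hc + hPc)
    have h0 := posPart_nonneg (d - N)
    have h1 : (d - N)⁺ ≤ d := by
      rw [posPart_def]
      exact sup_le (by linear_combination hN0) hd0
    have h2 : (d - N)⁺ ≤ P := by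
      rw [posPart_def]
      exact sup_le (by linear_combination hd) hP0
    have h3 := hP _ h0 h2
    have h4 := hN (d - (d - N)⁺) (sub_nonneg.2 h1) (by linear_combination le_posPart (d - N))
    rw [hF.map_sub hdL (s.L2_of_nonneg_of_le hdL h0 h1)] at h4
    linear_combination h3 + h4
  exact hPne (le_antisymm (by linear_combination hle) hP0)

lemma mul_self_mem_L1_of_chain (s : CESetup U) {C : Set U} {y k : U} (hC : C ⊆ s.L2)
    (h0 : ∀ x ∈ C, 0 ≤ x) (hy : y ∈ C) (hdir : DirectedOn (· ≤ ·) C)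
    (hlub : IsLUB C (sSup C)) (hT : ∀ x ∈ C, s.T (x * x) ≤ k) :
    sSup C * sSup C ∈ s.L1 := by
  have hd := s.mul_eq_zero_of_inf_eq_zero
  have hc0 : 0 ≤ sSup C := (h0 y hy).trans (hlub.1 hy)
  have hsub : (fun x => x * x) '' C ⊆ s.L1 := by
    rintro _ ⟨x, hx, rfl⟩
    exact (hC hx).2
  obtain ⟨hbdd, hmem⟩ := s.T_univComplete ((fun x => x * x) '' C) hsub ⟨_, y, hy, rfl⟩
    (by
      rintro _ ⟨x, hx, rfl⟩ _ ⟨z, hz, rfl⟩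
      obtain ⟨t, ht, hxt, hzt⟩ := hdir x hx z hz
      exact ⟨_, ⟨t, ht, rfl⟩, mul_le_mul hxt hxt (h0 x hx) (h0 t ht),
        mul_le_mul hzt hzt (h0 z hz) (h0 t ht)⟩)
    (by rintro _ ⟨x, hx, rfl⟩; exact s.mul_self_nonneg x)
    ⟨k, by rintro _ ⟨x, hx, rfl⟩; exact hT x hx⟩
  set q := sSup ((fun x => x * x) '' C)
  have hq : ∀ x ∈ C, x * x ≤ q := fun x hx => le_csSup hbdd ⟨x, hx, rfl⟩
  have hdec := decreasesToZero_sub_of_isLUB ⟨y, hy⟩ hdir hlub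
  have hmul : ∀ a : U, 0 ≤ a → (∀ x ∈ C, a * x ≤ q) → a * sSup C ≤ q := by
    intro a ha hax
    rw [← sub_nonpos]
    refine (hdec.mul_left hd ha).2.2.2 _ ?_
    rintro _ ⟨_, ⟨x, hx, rfl⟩, rfl⟩
    linear_combination hax x hx
  refine s.L1_of_nonneg_of_le hmem (_root_.mul_nonneg hc0 hc0) (hmul _ hc0 fun x hx => ?_)
  rw [mul_comm]
  refine hmul _ (h0 x hx) fun z hz => ?_
  obtain ⟨t, ht, hxt, hzt⟩ := hdir x hx z hz
  exact (mul_le_mul hxt hzt (h0 z hz) (h0 t ht)).trans (hq t ht)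

/-- A nonzero positive `T`-linear functional dominates one of the form `g ↦ T (h * g)` with
`0 ≤ h ≠ 0`. -/
lemma IsTLinear.exists_T_mul_le (hF : s.IsTLinear F) (hpos : ∀ g ∈ s.L2, 0 ≤ g → 0 ≤ F g)
    (h1 : F 1 ≠ 0) :
    ∃ h ∈ s.L2, 0 ≤ h ∧ h ≠ 0 ∧ ∀ g ∈ s.L2, 0 ≤ g → s.T (h * g) ≤ F g := by
  have hd := s.mul_eq_zero_of_inf_eq_zero
  obtain ⟨n, hn⟩ : ∃ n : ℕ, ¬ n * F 1 ≤ 1 := by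
    by_contra! hall
    exact h1 (le_antisymm (nonpos_of_forall_natCast_mul_le hall)
      (hpos 1 s.L2_one zero_le_one))
  have hn0 : n ≠ 0 := by
    rintro rfl
    exact hn (by simp)
  have hn1 : (1 : U) ≤ n := by
    simpa using Nat.mono_cast (α := U) (Nat.one_le_iff_ne_zero.2 hn0)
  have hH : s.IsTLinear (fun g => F (n * g) - s.T (1 * g)) :=
    (hF.comp_mul (Nat.cast_nonneg n) fun g hg => s.RT_mul_L2 (s.RT_natCast n) hg).sub
      (IsTLinear.of_mul_left s.L2_one)
  obtain ⟨P, hP0, hP1, hPne, hP⟩ := hH.exists_forall_nonneg s.L2_one zero_le_one (by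
    rw [hF.2.2.1 _ (s.RT_natCast n) 1 s.L2_one, one_mul, s.T_one]
    rwa [sub_nonpos])
  have hnP : (n : U) * ((n : ℝ)⁻¹ • P) = P := by
    rw [← nsmul_eq_mul, ← Nat.cast_smul_eq_nsmul ℝ, smul_smul,
      mul_inv_cancel₀ (Nat.cast_ne_zero.2 hn0), one_smul]
  have hh0 : 0 ≤ (n : ℝ)⁻¹ • P := smul_nonneg (by positivity) hP0
  have hPL := s.L2_of_nonneg_of_le s.L2_one hP0 hP1
  set h := (n : ℝ)⁻¹ • P
  have hhP : h ≤ P := by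
    rw [← hnP]
    exact le_mul_of_one_le_left hh0 hn1
  have hhL := s.L2_of_nonneg_of_le hPL hh0 hhP
  refine ⟨h, hhL, hh0, ?_, fun g hg hg0 => ?_⟩
  · intro h0
    rw [h0, mul_zero] at hnP
    exact hPne hnP.symm
  · have hPg : P * g ≤ g := mul_le_of_le_one_left hg0 hP1
    have hPgL := s.L2_of_nonneg_of_le hg (_root_.mul_nonneg hP0 hg0) hPg
    have h2 := hH.nonneg_mul hP0 hP1 hP hg hg0
    have h3 := hpos _ (s.L2_sub hg hPgL) (sub_nonneg.2 hPg)
    have h4 : s.T (1 * (P * g)) = n * s.T (h * g) := by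
      rw [← s.T_avg _ (s.RT_natCast n) _ (s.mul_mem_L1 hhL hg), one_mul, ← mul_assoc, hnP]
    beta_reduce at h2
    rw [h4, hF.2.2.1 _ (s.RT_natCast n) _ hPgL] at h2
    rw [hF.map_sub hg hPgL] at h3
    rw [← sub_nonpos]
    refine nonpos_of_mul_nonpos_of_one_le hd (v := n) ?_ hn1
    have h5 := mul_le_mul_of_nonneg_left h3 (Nat.cast_nonneg (α := U) n)
    linear_combination h2 + h5

lemma IsTLinear.exists_eq_T_mul_of_nonneg (hF : s.IsTLinear F)
    (hpos : ∀ g ∈ s.L2, 0 ≤ g → 0 ≤ F g) {k : U} (hk : 0 ≤ k)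
    (hbd : ∀ g ∈ s.L2, 0 ≤ g → F g ≤ k * s.norm2 g) :
    ∃ f ∈ s.L2, ∀ g ∈ s.L2, F g = s.T (f * g) := by
  have hd := s.mul_eq_zero_of_inf_eq_zero
  have hT2 : ∀ f ∈ s.L2, 0 ≤ f → (∀ g ∈ s.L2, 0 ≤ g → s.T (f * g) ≤ F g) →
      s.T (f * f) ≤ k * k := by
    intro f hf hf0 hfF
    have h1 := (hfF f hf hf0).trans (hbd f hf hf0)
    rw [← s.norm2_mul_self hf] at h1 ⊢
    have h2 := le_of_mul_self_le_mul hd (s.norm2_nonneg f) hk h1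
    exact mul_le_mul h2 h2 (s.norm2_nonneg f) hk
  obtain ⟨f, -, ⟨hf, hf0, hfF⟩, hmax⟩ := zorn_le_nonempty₀
    {f | f ∈ s.L2 ∧ 0 ≤ f ∧ ∀ g ∈ s.L2, 0 ≤ g → s.T (f * g) ≤ F g}
    (fun C hC hchain y hy => by
      have hL2 : C ⊆ s.L2 := fun x hx => (hC hx).1
      have h0 : ∀ x ∈ C, 0 ≤ x := fun x hx => (hC hx).2.1
      have hdir := hchain.directedOn
      obtain ⟨hbdd, hmem⟩ := s.T_univComplete C (fun x hx => (hC hx).1.1) ⟨y, hy⟩ hdir h0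
        ⟨F 1, fun x hx => by simpa using (hC hx).2.2 1 s.L2_one zero_le_one⟩
      have hlub : IsLUB C (sSup C) := isLUB_csSup ⟨y, hy⟩ hbdd
      have hcL : sSup C ∈ s.L2 := ⟨hmem, s.mul_self_mem_L1_of_chain hL2 h0 hy hdir hlub
        fun x hx => hT2 x (hC hx).1 (hC hx).2.1 (hC hx).2.2⟩
      refine ⟨sSup C, ⟨hcL, (h0 y hy).trans (hlub.1 hy), fun g hg hg0 => ?_⟩, hlub.1⟩
      rw [mul_comm]
      refine (IsTLinear.of_mul_left hg).le_of_isLUB hL2 hcL ⟨y, hy⟩ hdir hlub fun x hx => ?_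
      rw [mul_comm]
      exact (hC hx).2.2 g hg hg0)
    0 ⟨⟨s.L1_zero, by simpa using s.L1_zero⟩, le_rfl, fun g hg hg0 => by
      rw [zero_mul, s.T_fix 0 s.RT_zero]
      exact hpos g hg hg0⟩
  have hG := hF.sub (IsTLinear.of_mul_left hf)
  have hGpos : ∀ g ∈ s.L2, 0 ≤ g → 0 ≤ F g - s.T (f * g) := fun g hg hg0 =>
    sub_nonneg.2 (hfF g hg hg0)
  have hG1 : F 1 - s.T (f * 1) = 0 := by
    by_contra hne
    obtain ⟨h, hh, hh0, hhne, hhG⟩ := hG.exists_T_mul_le hGpos hne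
    have hle : f + h ≤ f := by
      refine hmax ⟨s.L2_add hf hh, add_nonneg hf0 hh0, fun g hg hg0 => ?_⟩
        (by linear_combination hh0)
      rw [add_mul, s.T_add _ (s.mul_mem_L1 hf hg) _ (s.mul_mem_L1 hh hg)]
      linear_combination hhG g hg hg0
    exact hhne (le_antisymm (by linear_combination hle) hh0)
  have hzero : ∀ g ∈ s.L2, 0 ≤ g → F g - s.T (f * g) = 0 := by
    intro g hg hg0
    have h1 := hG.neg.nonneg_mul zero_le_one le_rfl (fun c hc0 hc => by
      have hcL := s.L2_of_nonneg_of_le s.L2_one hc0 hc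
      have h2 := hGpos _ (s.L2_sub s.L2_one hcL) (sub_nonneg.2 hc)
      have h3 := hG.map_sub s.L2_one hcL
      linear_combination h2 + h3 + hG1) hg hg0
    rw [one_mul] at h1
    exact le_antisymm (by linear_combination h1) (hGpos g hg hg0)
  refine ⟨f, hf, fun g hg => ?_⟩
  have h1 := hG.map_sub (s.posPart_mem_L2 hg) (s.negPart_mem_L2 hg)
  rw [posPart_sub_negPart, hzero _ (s.posPart_mem_L2 hg) (posPart_nonneg g),
    hzero _ (s.negPart_mem_L2 hg) (negPart_nonneg g)] at h1
  linear_combination h1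

lemma mul_mem_L2_of_le_one (s : CESetup U) {M g : U} (hM0 : 0 ≤ M) (hM1 : M ≤ 1)
    (hg : g ∈ s.L2) : M * g ∈ s.L2 := by
  have hpos : ∀ g ∈ s.L2, 0 ≤ g → M * g ∈ s.L2 := fun g hg hg0 =>
    s.L2_of_nonneg_of_le hg (_root_.mul_nonneg hM0 hg0) (mul_le_of_le_one_left hg0 hM1)
  rw [← posPart_sub_negPart g, mul_sub]
  exact s.L2_sub (hpos _ (s.posPart_mem_L2 hg) (posPart_nonneg g))
    (hpos _ (s.negPart_mem_L2 hg) (negPart_nonneg g))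

lemma IsTLinear.exists_eq_T_mul (hF : s.IsTLinear F) (hb : s.IsStronglyBounded F) :
    ∃ f ∈ s.L2, ∀ g ∈ s.L2, F g = s.T (f * g) := by
  obtain ⟨k, -, hk, hkF⟩ := hb
  obtain ⟨N, hN0, hN1, hN, hP⟩ := hF.exists_hahn
  have key : ∀ G : U → U, s.IsTLinear G → (∀ g ∈ s.L2, G g ≤ k * s.norm2 g) →
      ∀ M, 0 ≤ M → M ≤ 1 → (∀ c, 0 ≤ c → c ≤ M → 0 ≤ G c) →
      ∃ f ∈ s.L2, ∀ g ∈ s.L2, G (M * g) = s.T (f * g) := by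
    intro G hG hGk M hM0 hM1 hM
    have hML : ∀ g ∈ s.L2, M * g ∈ s.L2 := fun g => s.mul_mem_L2_of_le_one hM0 hM1
    refine (hG.comp_mul hM0 hML).exists_eq_T_mul_of_nonneg
      (fun g hg hg0 => hG.nonneg_mul hM0 hM1 hM hg hg0) hk fun g hg hg0 => ?_
    exact (hGk _ (hML g hg)).trans (mul_le_mul_of_nonneg_left
      (s.norm2_mono hg (_root_.mul_nonneg hM0 hg0) (mul_le_of_le_one_left hg0 hM1)) hk)
  obtain ⟨f₁, hf₁, h₁⟩ := key F hF (fun g hg => (abs_le'.1 (hkF g hg)).1) (1 - N)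
    (sub_nonneg.2 hN1) (by linear_combination hN0) hP
  obtain ⟨f₂, hf₂, h₂⟩ := key _ hF.neg (fun g hg => (abs_le'.1 (hkF g hg)).2) N hN0 hN1
    fun c hc0 hc => neg_nonneg.2 (hN c hc0 hc)
  refine ⟨f₁ - f₂, s.L2_sub hf₁ hf₂, fun g hg => ?_⟩
  have hNg := s.mul_mem_L2_of_le_one hN0 hN1 hg
  have h3 := h₁ g hg
  have h4 := h₂ g hg
  rw [sub_mul, one_mul, hF.map_sub hg hNg] at h3
  rw [sub_mul, s.T_sub (s.mul_mem_L1 hf₁ hg) (s.mul_mem_L1 hf₂ hg)]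
  linear_combination h3 - h4

/-- `Ψ` is norm preserving. -/
lemma opNorm_eq_norm2 (s : CESetup U) {f : U} (hf : f ∈ s.L2) :
    s.opNorm (fun g => s.T (f * g)) = s.norm2 f := by
  refine IsLeast.csInf_eq ⟨⟨s.norm2_mem_RT hf, s.norm2_nonneg f, fun g hg =>
    s.abs_T_mul_le hf hg⟩, ?_⟩
  rintro k ⟨-, hk, hkf⟩
  refine le_of_mul_self_le_mul s.mul_eq_zero_of_inf_eq_zero (s.norm2_nonneg f) hk ?_
  rw [s.norm2_mul_self hf]
  exact (le_abs_self _).trans (hkf f hf)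

lemma eq_of_T_mul_eq (s : CESetup U) {f f' : U} (hf : f ∈ s.L2) (hf' : f' ∈ s.L2)
    (h : ∀ g ∈ s.L2, s.T (f * g) = s.T (f' * g)) : f = f' := by
  have hL := s.L2_sub hf hf'
  rw [← sub_eq_zero]
  refine eq_zero_of_mul_self_eq_zero s.mul_eq_zero_of_inf_eq_zero
    (s.T_strict _ hL.2 (s.mul_self_nonneg _) ?_)
  rw [sub_mul, s.T_sub (s.mul_mem_L1 hf hL) (s.mul_mem_L1 hf' hL), h _ hL, sub_self]

end CESetup

/-- The map `Ψ` defined by `Ψ(f)(g) := T(fg)` for `f, g ∈ L²(T)` is a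
bijection between `E = L²(T)` and its `T`-strong dual `Ê`; moreover `Ψ` is additive,
`R(T)`-homogeneous, and `R(T)`-valued norm preserving: `‖Ψ(f)‖ = ‖f‖_{T,2}`. -/
theorem ce_strong_dual_identification {U : Type*} [CommRing U]
    [ConditionallyCompleteLattice U] [CovariantClass U U (· + ·) (· ≤ ·)]
    [Module ℝ U] [PosSMulMono ℝ U] (s : CESetup U) :
    (∀ f ∈ s.L2, s.IsTLinear (fun g => s.T (f * g)) ∧
      s.IsStronglyBounded (fun g => s.T (f * g))) ∧
    (∀ f ∈ s.L2, ∀ f' ∈ s.L2,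
      (∀ g ∈ s.L2, s.T (f * g) = s.T (f' * g)) → f = f') ∧
    (∀ F : U → U, s.IsTLinear F → s.IsStronglyBounded F →
      ∃ f ∈ s.L2, ∀ g ∈ s.L2, F g = s.T (f * g)) ∧
    (∀ f ∈ s.L2, ∀ f' ∈ s.L2, ∀ g ∈ s.L2,
      s.T ((f + f') * g) = s.T (f * g) + s.T (f' * g)) ∧
    (∀ r ∈ s.RT, ∀ f ∈ s.L2, ∀ g ∈ s.L2, s.T ((r * f) * g) = r * s.T (f * g)) ∧
    (∀ f ∈ s.L2, s.opNorm (fun g => s.T (f * g)) = s.norm2 f) := by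
  have := s.isOrderedRing
  refine ⟨fun f hf => ⟨CESetup.IsTLinear.of_mul_left hf, s.norm2 f, s.norm2_mem_RT hf,
    s.norm2_nonneg f, fun g hg => s.abs_T_mul_le hf hg⟩,
    fun f hf f' hf' h => s.eq_of_T_mul_eq hf hf' h, fun F hF hb => hF.exists_eq_T_mul hb,
    fun f hf f' hf' g hg => ?_, fun r hr f hf g hg => ?_, fun f hf => s.opNorm_eq_norm2 hf⟩
  · rw [add_mul, s.T_add _ (s.mul_mem_L1 hf hg) _ (s.mul_mem_L1 hf' hg)]
  · rw [mul_assoc, s.T_avg r hr _ (s.mul_mem_L1 hf hg)]
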